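/- arXiv:2202.13691 — 3 statements merged into one kernel-verified Lean document; each statement's English description precedes it below -/
import Mathlib

section
/- Under the stated setup (quadrature exactness degree n+k with 0 < k ≤ n), for every f ∈ C([−1,1]) the identity ⟨L_k f, L_k f⟩_m + ⟨f, (L_n − L_k)f⟩_m + σ_{n,k,f} + ⟨f − L_n f, f − L_n f⟩_m = ⟨f, f⟩_m holds, where (L_n − L_k)f = ∑_{ℓ=k+1}^{n} ⟨f, p_ℓ⟩_m p_ℓ and σ_{n,k,f} = ⟨L_n f − L_k f, L_n f − L_k f⟩ − ⟨L_n f − L_k f, L_n f − L_k f⟩_m is the quadrature error for the integrand (L_n f − L_k f)². -/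
open MeasureTheory

/-- The discrete inner product `⟨v,z⟩_m = ∑_j w_j v(x_j) z(x_j)` of an m-point
quadrature rule with points `x` and weights `w`. -/
noncomputable def discInner {m : ℕ} (w x : Fin m → ℝ) (v z : ℝ → ℝ) : ℝ :=
  ∑ j, w j * v (x j) * z (x j)

/-- The hyperinterpolant of degree `t`:  `L_t f = ∑_{ℓ=0}^{t} ⟨f, p_ℓ⟩_m p_ℓ`. -/
noncomputable def hyper {m : ℕ} (w x : Fin m → ℝ) (p : ℕ → Polynomial ℝ)
    (t : ℕ) (f : ℝ → ℝ) : Polynomial ℝ :=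
  ∑ ℓ ∈ Finset.range (t + 1),
    Polynomial.C (discInner w x f (fun y => (p ℓ).eval y)) * p ℓ

/-- The "tail" operator `(L_n − L_k) f = ∑_{ℓ=k+1}^{n} ⟨f, p_ℓ⟩_m p_ℓ`. -/
noncomputable def hyperDiff {m : ℕ} (w x : Fin m → ℝ) (p : ℕ → Polynomial ℝ)
    (k n : ℕ) (f : ℝ → ℝ) : Polynomial ℝ :=
  ∑ ℓ ∈ Finset.Ioc k n,
    Polynomial.C (discInner w x f (fun y => (p ℓ).eval y)) * p ℓ

/-- The continuous inner product of two expansions in an orthonormal family. -/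
theorem integral_sum_mul_sum_of_orthonormal {p : ℕ → Polynomial ℝ} {n : ℕ}
    (horth : ∀ ℓ ℓ', ℓ ≤ n → ℓ' ≤ n →
      (∫ y in (-1 : ℝ)..1, (p ℓ).eval y * (p ℓ').eval y) = if ℓ = ℓ' then 1 else 0)
    (c d : ℕ → ℝ) {s t : Finset ℕ} (hs : ∀ ℓ ∈ s, ℓ ≤ n) (ht : ∀ ℓ ∈ t, ℓ ≤ n) :
    (∫ y in (-1 : ℝ)..1, (∑ ℓ ∈ s, Polynomial.C (c ℓ) * p ℓ).eval y *
      (∑ ℓ ∈ t, Polynomial.C (d ℓ) * p ℓ).eval y) = ∑ ℓ ∈ s ∩ t, c ℓ * d ℓ := by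
  have hexpand : ∀ y : ℝ, (∑ ℓ ∈ s, Polynomial.C (c ℓ) * p ℓ).eval y *
      (∑ ℓ ∈ t, Polynomial.C (d ℓ) * p ℓ).eval y =
      ∑ i ∈ s, ∑ j ∈ t, c i * d j * ((p i).eval y * (p j).eval y) := by
    intro y
    simp only [Polynomial.eval_finsetSum, Polynomial.eval_mul, Polynomial.eval_C,
      Finset.sum_mul_sum]
    exact Finset.sum_congr rfl fun i _ => Finset.sum_congr rfl fun j _ => by ring
  simp only [hexpand]
  rw [intervalIntegral.integral_finsetSum fun i _ =>
    Continuous.intervalIntegrable (by fun_prop) _ _, ← Finset.filter_mem_eq_inter,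
    Finset.sum_filter]
  refine Finset.sum_congr rfl fun i hi => ?_
  rw [intervalIntegral.integral_finsetSum fun j _ =>
    Continuous.intervalIntegrable (by fun_prop) _ _]
  rw [Finset.sum_congr rfl fun j hj => by
    rw [intervalIntegral.integral_const_mul, horth i j (hs i hi) (ht j hj), mul_ite, mul_one,
      mul_zero]]
  exact Finset.sum_ite_eq t i _

/-- The discrete inner product of a function with a polynomial expansion. -/
theorem discInner_sum_C_mul {m : ℕ} (w x : Fin m → ℝ) (p : ℕ → Polynomial ℝ)
    (f : ℝ → ℝ) (c : ℕ → ℝ) (s : Finset ℕ) :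
    discInner w x f (fun y => (∑ ℓ ∈ s, Polynomial.C (c ℓ) * p ℓ).eval y) =
      ∑ ℓ ∈ s, c ℓ * discInner w x f (fun y => (p ℓ).eval y) := by
  simp only [discInner, Polynomial.eval_finsetSum, Polynomial.eval_mul, Polynomial.eval_C,
    Finset.mul_sum]
  rw [Finset.sum_comm]
  exact Finset.sum_congr rfl fun i _ => Finset.sum_congr rfl fun j _ => by ring

/-- An expansion in polynomials of degree at most `t` has degree at most `t`. -/
theorem natDegree_sum_C_mul_le {p : ℕ → Polynomial ℝ} (c : ℕ → ℝ) {s : Finset ℕ} {t : ℕ}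
    (h : ∀ ℓ ∈ s, (p ℓ).natDegree ≤ t) :
    (∑ ℓ ∈ s, Polynomial.C (c ℓ) * p ℓ).natDegree ≤ t :=
  Polynomial.natDegree_sum_le_of_forall_le s _ fun ℓ hℓ =>
    (Polynomial.natDegree_C_mul_le _ _).trans (h ℓ hℓ)

/-- Exactness turns the discrete inner product of polynomials into the continuous one. -/
theorem discInner_eq_integral_of_exact {m N : ℕ} {w x : Fin m → ℝ}
    (hex : ∀ g : Polynomial ℝ, g.natDegree ≤ N →
      ∑ j, w j * g.eval (x j) = ∫ y in (-1 : ℝ)..1, g.eval y)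
    {q r : Polynomial ℝ} (h : q.natDegree + r.natDegree ≤ N) :
    discInner w x (fun y => q.eval y) (fun y => r.eval y) =
      ∫ y in (-1 : ℝ)..1, q.eval y * r.eval y := by
  have := hex (q * r) (Polynomial.natDegree_mul_le.trans h)
  simpa only [discInner, Polynomial.eval_mul, mul_assoc] using this

/-- The tail operator is the difference of the two hyperinterpolants. -/
theorem hyper_add_hyperDiff {m : ℕ} (w x : Fin m → ℝ) (p : ℕ → Polynomial ℝ) {k n : ℕ}
    (hkn : k ≤ n) (f : ℝ → ℝ) :
    hyper w x p k f + hyperDiff w x p k n f = hyper w x p n f := by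
  have hIoc : Finset.Ioc k n = Finset.Ico (k + 1) (n + 1) := by
    ext; simp only [Finset.mem_Ioc, Finset.mem_Ico]; omega
  rw [hyper, hyperDiff, hyper, hIoc]
  exact Finset.sum_range_add_sum_Ico _ (by omega)

/-- `⟨L_k f,L_k f⟩_m + ⟨f,(L_n−L_k)f⟩_m + σ_{n,k,f} + ⟨f−L_n f, f−L_n f⟩_m = ⟨f,f⟩_m`, where `σ_{n,k,f}` is the quadrature error for `(L_n f − L_k f)²`. -/
theorem key_identity_sigma
    (n k m : ℕ) (hn : 1 ≤ n) (hk0 : 0 < k) (hkn : k ≤ n)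
    (x w : Fin m → ℝ)
    (hx : ∀ j, x j ∈ Set.Icc (-1 : ℝ) 1)
    (hw : ∀ j, 0 < w j)
    (hex : ∀ g : Polynomial ℝ, g.natDegree ≤ n + k →
      ∑ j, w j * g.eval (x j) = ∫ y in (-1 : ℝ)..1, g.eval y)
    (p : ℕ → Polynomial ℝ)
    (hdeg : ∀ ℓ, ℓ ≤ n → (p ℓ).natDegree = ℓ)
    (horth : ∀ ℓ ℓ', ℓ ≤ n → ℓ' ≤ n →
      (∫ y in (-1 : ℝ)..1, (p ℓ).eval y * (p ℓ').eval y) = if ℓ = ℓ' then 1 else 0)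
    (f : ℝ → ℝ) (hf : ContinuousOn f (Set.Icc (-1 : ℝ) 1))
    :
    discInner w x (fun y => (hyper w x p k f).eval y) (fun y => (hyper w x p k f).eval y) +
        discInner w x f (fun y => (hyperDiff w x p k n f).eval y) +
        ((∫ y in (-1 : ℝ)..1, ((hyper w x p n f).eval y - (hyper w x p k f).eval y) * ((hyper w x p n f).eval y - (hyper w x p k f).eval y)) -
          discInner w x (fun y => (hyper w x p n f).eval y - (hyper w x p k f).eval y)
            (fun y => (hyper w x p n f).eval y - (hyper w x p k f).eval y)) +
        discInner w x (fun y => f y - (hyper w x p n f).eval y) (fun y => f y - (hyper w x p n f).eval y) =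
      discInner w x f f := by
  have hk : ∀ ℓ ∈ Finset.range (k + 1), ℓ ≤ k := fun ℓ hℓ =>
    Nat.lt_succ_iff.mp (Finset.mem_range.mp hℓ)
  have hkn' : ∀ ℓ ∈ Finset.range (k + 1), ℓ ≤ n := fun ℓ hℓ => (hk ℓ hℓ).trans hkn
  have htail : ∀ ℓ ∈ Finset.Ioc k n, ℓ ≤ n := fun ℓ hℓ => (Finset.mem_Ioc.mp hℓ).2
  have hdisj : Finset.range (k + 1) ∩ Finset.Ioc k n = ∅ := by
    refine Finset.eq_empty_of_forall_notMem fun ℓ hℓ => ?_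
    rw [Finset.mem_inter, Finset.mem_range, Finset.mem_Ioc] at hℓ
    omega
  have hdegk : (hyper w x p k f).natDegree ≤ k :=
    natDegree_sum_C_mul_le _ fun ℓ hℓ => (hdeg ℓ (hkn' ℓ hℓ)).trans_le (hk ℓ hℓ)
  have hdegD : (hyperDiff w x p k n f).natDegree ≤ n :=
    natDegree_sum_C_mul_le _ fun ℓ hℓ => (hdeg ℓ (htail ℓ hℓ)).trans_le (htail ℓ hℓ)
  have hLL : discInner w x (fun y => (hyper w x p k f).eval y)
      (fun y => (hyper w x p k f).eval y) =
      discInner w x f (fun y => (hyper w x p k f).eval y) := by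
    rw [discInner_eq_integral_of_exact hex (by omega), hyper,
      integral_sum_mul_sum_of_orthonormal horth _ _ hkn' hkn', Finset.inter_self,
      discInner_sum_C_mul]
  have hLD : discInner w x (fun y => (hyper w x p k f).eval y)
      (fun y => (hyperDiff w x p k n f).eval y) = 0 := by
    rw [discInner_eq_integral_of_exact hex (by omega), hyper, hyperDiff,
      integral_sum_mul_sum_of_orthonormal horth _ _ hkn' htail, hdisj, Finset.sum_empty]
  have hDD : (∫ y in (-1 : ℝ)..1,
      (hyperDiff w x p k n f).eval y * (hyperDiff w x p k n f).eval y) =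
      discInner w x f (fun y => (hyperDiff w x p k n f).eval y) := by
    rw [hyperDiff, integral_sum_mul_sum_of_orthonormal horth _ _ htail htail,
      Finset.inter_self, discInner_sum_C_mul]
  simp only [← hyper_add_hyperDiff w x p hkn f, Polynomial.eval_add, add_sub_cancel_left]
  have hres : discInner w x
      (fun y => f y - ((hyper w x p k f).eval y + (hyperDiff w x p k n f).eval y))
      (fun y => f y - ((hyper w x p k f).eval y + (hyperDiff w x p k n f).eval y)) =
      discInner w x f f - 2 * discInner w x f (fun y => (hyper w x p k f).eval y)
        - 2 * discInner w x f (fun y => (hyperDiff w x p k n f).eval y)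
        + discInner w x (fun y => (hyper w x p k f).eval y) (fun y => (hyper w x p k f).eval y)
        + 2 * discInner w x (fun y => (hyper w x p k f).eval y)
          (fun y => (hyperDiff w x p k n f).eval y)
        + discInner w x (fun y => (hyperDiff w x p k n f).eval y)
          (fun y => (hyperDiff w x p k n f).eval y) := by
    simp only [discInner, Finset.mul_sum, ← Finset.sum_add_distrib, ← Finset.sum_sub_distrib]
    exact Finset.sum_congr rfl fun j _ => by ring
  linarith
end

section
/- Under the stated setup (quadrature exactness degree n+k with 0 < k ≤ n) and assuming the Marcinkiewicz–Zygmund property with constant η ∈ (0,1), for every f ∈ C([−1,1]) the quadrature error σ_{n,k,f} = ⟨L_n f − L_k f, L_n f − L_k f⟩ − ⟨L_n f − L_k f, L_n f − L_k f⟩_m satisfies |σ_{n,k,f}| ≤ η ⟨f, (L_n − L_k)f⟩_m, where (L_n − L_k)f = ∑_{ℓ=k+1}^{n} ⟨f, p_ℓ⟩_m p_ℓ. -/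
open MeasureTheory

/-- The tail operator is the difference of two hyperinterpolants. -/
lemma hyper_sub_hyper {m : ℕ} (w x : Fin m → ℝ) (p : ℕ → Polynomial ℝ) {k n : ℕ}
    (hkn : k ≤ n) (f : ℝ → ℝ) :
    hyper w x p n f - hyper w x p k f = hyperDiff w x p k n f := by
  have hIoc : Finset.Ioc k n = Finset.Ico (k + 1) (n + 1) := by
    ext
    simp only [Finset.mem_Ioc, Finset.mem_Ico]
    omega
  rw [hyper, hyper, hyperDiff, hIoc, Finset.sum_Ico_eq_sub _ (by omega)]

lemma natDegree_hyperDiff_le {m : ℕ} (w x : Fin m → ℝ) {p : ℕ → Polynomial ℝ} {k n : ℕ}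
    (hdeg : ∀ ℓ, ℓ ≤ n → (p ℓ).natDegree = ℓ) (f : ℝ → ℝ) :
    (hyperDiff w x p k n f).natDegree ≤ n := by
  refine Polynomial.natDegree_sum_le_of_forall_le _ _ fun ℓ hℓ => ?_
  have hℓn : ℓ ≤ n := (Finset.mem_Ioc.mp hℓ).2
  exact (Polynomial.natDegree_C_mul_le _ _).trans ((hdeg ℓ hℓn).trans_le hℓn)

lemma discInner_hyperDiff {m : ℕ} (w x : Fin m → ℝ) (p : ℕ → Polynomial ℝ) (k n : ℕ)
    (f : ℝ → ℝ) :
    discInner w x f (fun y => (hyperDiff w x p k n f).eval y) =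
      ∑ ℓ ∈ Finset.Ioc k n, discInner w x f (fun y => (p ℓ).eval y) ^ 2 := by
  have key : ∀ c : ℕ → ℝ,
      discInner w x f (fun y => (∑ ℓ ∈ Finset.Ioc k n, Polynomial.C (c ℓ) * p ℓ).eval y) =
        ∑ ℓ ∈ Finset.Ioc k n, c ℓ * discInner w x f (fun y => (p ℓ).eval y) := by
    intro c
    simp only [discInner, Polynomial.eval_finsetSum, Polynomial.eval_mul, Polynomial.eval_C,
      Finset.mul_sum]
    rw [Finset.sum_comm]
    refine Finset.sum_congr rfl fun ℓ _ => Finset.sum_congr rfl fun j _ => ?_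
    ring
  simp only [hyperDiff, key, sq]

/-- Parseval's identity for the tail operator. -/
lemma integral_hyperDiff_sq {m : ℕ} (w x : Fin m → ℝ) {p : ℕ → Polynomial ℝ} {k n : ℕ}
    (horth : ∀ ℓ ℓ', ℓ ≤ n → ℓ' ≤ n →
      (∫ y in (-1 : ℝ)..1, (p ℓ).eval y * (p ℓ').eval y) = if ℓ = ℓ' then 1 else 0)
    (f : ℝ → ℝ) :
    ∫ y in (-1 : ℝ)..1, (hyperDiff w x p k n f).eval y ^ 2 =
      ∑ ℓ ∈ Finset.Ioc k n, discInner w x f (fun y => (p ℓ).eval y) ^ 2 := by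
  set c : ℕ → ℝ := fun ℓ => discInner w x f (fun y => (p ℓ).eval y) with hc
  have hexpand : ∀ y : ℝ, (hyperDiff w x p k n f).eval y ^ 2 =
      ∑ i ∈ Finset.Ioc k n, ∑ j ∈ Finset.Ioc k n,
        c i * c j * ((p i).eval y * (p j).eval y) := by
    intro y
    simp only [hyperDiff, Polynomial.eval_finsetSum, Polynomial.eval_mul, Polynomial.eval_C, sq,
      Finset.sum_mul_sum]
    refine Finset.sum_congr rfl fun i _ => Finset.sum_congr rfl fun j _ => ?_
    simp only [hc]
    ring
  simp only [hexpand]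
  rw [intervalIntegral.integral_finsetSum
    fun i _ => Continuous.intervalIntegrable (by fun_prop) _ _]
  refine Finset.sum_congr rfl fun i hi => ?_
  rw [intervalIntegral.integral_finsetSum
    fun j _ => Continuous.intervalIntegrable (by fun_prop) _ _]
  rw [Finset.sum_eq_single_of_mem i hi]
  · rw [intervalIntegral.integral_const_mul, horth i i (Finset.mem_Ioc.mp hi).2
      (Finset.mem_Ioc.mp hi).2, if_pos rfl]
    ring
  · intro j hj hji
    rw [intervalIntegral.integral_const_mul, horth i j (Finset.mem_Ioc.mp hi).2
      (Finset.mem_Ioc.mp hj).2, if_neg hji.symm, mul_zero]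

/-- with the Marcinkiewicz–Zygmund property, `|σ_{n,k,f}| ≤ η ⟨f, (L_n−L_k)f⟩_m`. -/
theorem sigma_bound_MZ
    (n k m : ℕ) (hn : 1 ≤ n) (hk0 : 0 < k) (hkn : k ≤ n)
    (x w : Fin m → ℝ)
    (hx : ∀ j, x j ∈ Set.Icc (-1 : ℝ) 1)
    (hw : ∀ j, 0 < w j)
    (hex : ∀ g : Polynomial ℝ, g.natDegree ≤ n + k →
      ∑ j, w j * g.eval (x j) = ∫ y in (-1 : ℝ)..1, g.eval y)
    (p : ℕ → Polynomial ℝ)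
    (hdeg : ∀ ℓ, ℓ ≤ n → (p ℓ).natDegree = ℓ)
    (horth : ∀ ℓ ℓ', ℓ ≤ n → ℓ' ≤ n →
      (∫ y in (-1 : ℝ)..1, (p ℓ).eval y * (p ℓ').eval y) = if ℓ = ℓ' then 1 else 0)
    (η : ℝ) (hη : η ∈ Set.Ioo (0 : ℝ) 1)
    (hMZ : ∀ χ : Polynomial ℝ, χ.natDegree ≤ n →
      |(∑ j, w j * (χ.eval (x j)) ^ 2) - ∫ y in (-1 : ℝ)..1, (χ.eval y) ^ 2| ≤
        η * ∫ y in (-1 : ℝ)..1, (χ.eval y) ^ 2)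
    (f : ℝ → ℝ) (hf : ContinuousOn f (Set.Icc (-1 : ℝ) 1))
    :
    |(∫ y in (-1 : ℝ)..1, ((hyper w x p n f).eval y - (hyper w x p k f).eval y) * ((hyper w x p n f).eval y - (hyper w x p k f).eval y)) -
        discInner w x (fun y => (hyper w x p n f).eval y - (hyper w x p k f).eval y)
          (fun y => (hyper w x p n f).eval y - (hyper w x p k f).eval y)| ≤
      η * discInner w x f (fun y => (hyperDiff w x p k n f).eval y) := by
  have hsub : ∀ y, (hyper w x p n f).eval y - (hyper w x p k f).eval y =
      (hyperDiff w x p k n f).eval y := fun y => by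
    rw [← Polynomial.eval_sub, hyper_sub_hyper w x p hkn f]
  have hMZ' := hMZ _ (natDegree_hyperDiff_le w x (k := k) hdeg f)
  rw [abs_sub_comm] at hMZ'
  simp only [hsub]
  rw [discInner_hyperDiff, ← integral_hyperDiff_sq w x horth f]
  simpa only [discInner, sq, mul_assoc] using hMZ'
end

section
/- Error bound for hyperinterpolation with relaxed exactness: under the stated setup (quadrature exactness degree n+k with 0 < k ≤ n) and assuming the Marcinkiewicz–Zygmund property with constant η ∈ (0,1), for every f ∈ C([−1,1]) one has ‖L_n f − f‖₂ ≤ (1/√(1−η) + 1) · 2^{1/2} · E_k(f), where E_k(f) = inf_{χ ∈ ℙ_k} sup_{x∈[−1,1]} |f(x) − χ(x)| is the best uniform polynomial approximation error of degree k. -/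
open MeasureTheory

open Polynomial in
/-- Polynomials `p 0, …, p (t - 1)` with `deg (p ℓ) = ℓ` span all polynomials of degree `< t`. -/
lemma exists_eq_sum_of_degree_lt {p : ℕ → Polynomial ℝ} {t : ℕ}
    (hdeg : ∀ ℓ < t, (p ℓ).degree = ℓ) {q : Polynomial ℝ} (hq : q.degree < t) :
    ∃ c : ℕ → ℝ, q = ∑ ℓ ∈ Finset.range t, C (c ℓ) * p ℓ := by
  induction t generalizing q with
  | zero =>
    refine ⟨0, ?_⟩
    have : q = 0 := by simpa [Polynomial.degree_lt_iff_coeff_zero, Polynomial.ext_iff] using hq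
    simp [this]
  | succ t ih =>
    have hpt := hdeg t (Nat.lt_succ_self t)
    have hlead : (p t).coeff t ≠ 0 := Polynomial.coeff_ne_zero_of_eq_degree hpt
    have hsub : (q - C (q.coeff t / (p t).coeff t) * p t).degree < t := by
      rw [Polynomial.degree_lt_iff_coeff_zero] at hq ⊢
      intro i hi
      rw [coeff_sub, coeff_C_mul]
      rcases hi.eq_or_lt with rfl | hi
      · rw [div_mul_cancel₀ _ hlead, sub_self]
      · have hpi : (p t).coeff i = 0 :=
          coeff_eq_zero_of_degree_lt (by rw [hpt]; exact_mod_cast hi)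
        rw [hq i hi, hpi, mul_zero, sub_zero]
    obtain ⟨c, hc⟩ := ih (fun ℓ hℓ => hdeg ℓ (hℓ.trans t.lt_succ_self)) hsub
    refine ⟨Function.update c t (q.coeff t / (p t).coeff t), ?_⟩
    rw [Finset.sum_range_succ, Function.update_self, ← sub_eq_iff_eq_add, hc]
    refine Finset.sum_congr rfl fun ℓ hℓ => ?_
    rw [Function.update_of_ne (Finset.mem_range.mp hℓ).ne]

/-- Integration of a linear combination of polynomials against a polynomial. -/
lemma integral_sum_C_mul_eval_mul (s : Finset ℕ) (c : ℕ → ℝ) (p : ℕ → Polynomial ℝ)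
    (q : Polynomial ℝ) (a b : ℝ) :
    ∫ y in a..b, (∑ ℓ ∈ s, Polynomial.C (c ℓ) * p ℓ).eval y * q.eval y =
      ∑ ℓ ∈ s, c ℓ * ∫ y in a..b, (p ℓ).eval y * q.eval y := by
  simp only [Polynomial.eval_finsetSum, Polynomial.eval_mul, Polynomial.eval_C, Finset.sum_mul,
    mul_assoc]
  rw [intervalIntegral.integral_finsetSum]
  · simp only [intervalIntegral.integral_const_mul]
  · intro ℓ _
    exact Continuous.intervalIntegrable (by fun_prop) _ _

/-- Fourier coefficients of a linear combination of orthonormal polynomials. -/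
lemma integral_sum_C_mul_eval_mul_orthonormal {n : ℕ} {p : ℕ → Polynomial ℝ} {a b : ℝ}
    (horth : ∀ ℓ ℓ', ℓ ≤ n → ℓ' ≤ n →
      (∫ y in a..b, (p ℓ).eval y * (p ℓ').eval y) = if ℓ = ℓ' then 1 else 0)
    (c : ℕ → ℝ) {i : ℕ} (hi : i ≤ n) :
    ∫ y in a..b, (∑ ℓ ∈ Finset.range (n + 1), Polynomial.C (c ℓ) * p ℓ).eval y * (p i).eval y =
      c i := by
  rw [integral_sum_C_mul_eval_mul, Finset.sum_eq_single i]
  · rw [horth i i hi hi, if_pos rfl, mul_one]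
  · intro ℓ hℓ hne
    rw [horth ℓ i (Nat.lt_succ_iff.mp (Finset.mem_range.mp hℓ)) hi, if_neg hne, mul_zero]
  · intro h
    exact absurd (Finset.mem_range.mpr (Nat.lt_succ_iff.mpr hi)) h

lemma discInner_sub_left {m : ℕ} (w x : Fin m → ℝ) (u v z : ℝ → ℝ) :
    discInner w x (fun y => u y - v y) z = discInner w x u z - discInner w x v z := by
  simp only [discInner, ← Finset.sum_sub_distrib]
  exact Finset.sum_congr rfl fun j _ => by ring

lemma hyper_sub {m : ℕ} (w x : Fin m → ℝ) (p : ℕ → Polynomial ℝ) (t : ℕ) (u v : ℝ → ℝ) :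
    hyper w x p t (fun y => u y - v y) = hyper w x p t u - hyper w x p t v := by
  simp only [hyper, discInner_sub_left, ← Finset.sum_sub_distrib, Polynomial.C_sub, sub_mul]

/-- Hyperinterpolation of degree `n` with a rule of exactness degree `n + k` reproduces
polynomials of degree at most `k ≤ n`. -/
lemma hyper_eval_eq_self {n k m : ℕ} (hkn : k ≤ n) {x w : Fin m → ℝ}
    (hex : ∀ g : Polynomial ℝ, g.natDegree ≤ n + k →
      ∑ j, w j * g.eval (x j) = ∫ y in (-1 : ℝ)..1, g.eval y)
    {p : ℕ → Polynomial ℝ} (hdeg : ∀ ℓ, ℓ ≤ n → (p ℓ).natDegree = ℓ)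
    (horth : ∀ ℓ ℓ', ℓ ≤ n → ℓ' ≤ n →
      (∫ y in (-1 : ℝ)..1, (p ℓ).eval y * (p ℓ').eval y) = if ℓ = ℓ' then 1 else 0)
    {χ : Polynomial ℝ} (hχ : χ.natDegree ≤ k) :
    hyper w x p n (fun y => χ.eval y) = χ := by
  have hdegree : ∀ ℓ < n + 1, (p ℓ).degree = ℓ := by
    intro ℓ hℓ
    have hℓn := Nat.lt_succ_iff.mp hℓ
    have hne : p ℓ ≠ 0 := by
      intro h0
      simpa [h0] using horth ℓ ℓ hℓn hℓn
    rw [Polynomial.degree_eq_natDegree hne, hdeg ℓ hℓn]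
  obtain ⟨c, hc⟩ := exists_eq_sum_of_degree_lt hdegree
    (q := χ) (Polynomial.degree_le_natDegree.trans_lt (by exact_mod_cast (by omega)))
  rw [hyper]
  conv_rhs => rw [hc]
  refine Finset.sum_congr rfl fun ℓ hℓ => ?_
  have hℓn := Nat.lt_succ_iff.mp (Finset.mem_range.mp hℓ)
  have hcoeff := hex (χ * p ℓ) (Polynomial.natDegree_mul_le.trans (by rw [hdeg ℓ hℓn]; omega))
  simp only [Polynomial.eval_mul, ← mul_assoc] at hcoeff
  rw [discInner, hcoeff, hc, integral_sum_C_mul_eval_mul_orthonormal horth c hℓn]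

/-- `‖L_n g‖₂² = ⟨g, L_n g⟩_m`. -/
lemma integral_hyper_sq {n m : ℕ} (w x : Fin m → ℝ) {p : ℕ → Polynomial ℝ}
    (horth : ∀ ℓ ℓ', ℓ ≤ n → ℓ' ≤ n →
      (∫ y in (-1 : ℝ)..1, (p ℓ).eval y * (p ℓ').eval y) = if ℓ = ℓ' then 1 else 0)
    (g : ℝ → ℝ) :
    ∫ y in (-1 : ℝ)..1, ((hyper w x p n g).eval y) ^ 2 =
      discInner w x g (fun y => (hyper w x p n g).eval y) := by
  have hfourier : ∀ ℓ ∈ Finset.range (n + 1),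
      ∫ y in (-1 : ℝ)..1, (p ℓ).eval y * (hyper w x p n g).eval y =
        discInner w x g (fun y => (p ℓ).eval y) := by
    intro ℓ hℓ
    simp only [mul_comm ((p ℓ).eval _)]
    exact integral_sum_C_mul_eval_mul_orthonormal horth _
      (Nat.lt_succ_iff.mp (Finset.mem_range.mp hℓ))
  have hexpand := integral_sum_C_mul_eval_mul (Finset.range (n + 1))
    (fun ℓ => discInner w x g (fun y => (p ℓ).eval y)) p (hyper w x p n g) (-1) 1
  simp only [pow_two]
  refine hexpand.trans
    ((Finset.sum_congr rfl fun ℓ hℓ => congrArg _ (hfourier ℓ hℓ)).trans ?_)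
  simp only [hyper, discInner, Polynomial.eval_finsetSum, Polynomial.eval_mul,
    Polynomial.eval_C, Finset.mul_sum]
  rw [Finset.sum_comm]
  exact Finset.sum_congr rfl fun j _ => Finset.sum_congr rfl fun ℓ _ => by ring

lemma natDegree_hyper_le {n m : ℕ} (w x : Fin m → ℝ) {p : ℕ → Polynomial ℝ}
    (hdeg : ∀ ℓ, ℓ ≤ n → (p ℓ).natDegree = ℓ) (g : ℝ → ℝ) :
    (hyper w x p n g).natDegree ≤ n := by
  refine Polynomial.natDegree_sum_le_of_forall_le _ _ fun ℓ hℓ => ?_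
  have hℓn := Nat.lt_succ_iff.mp (Finset.mem_range.mp hℓ)
  exact (Polynomial.natDegree_C_mul_le _ _).trans ((hdeg ℓ hℓn).trans_le hℓn)

/-- Stability of hyperinterpolation under the Marcinkiewicz–Zygmund property:
`‖L_n g‖₂² ≤ 2 (1 + η) ‖g‖_∞²`. -/
lemma integral_hyper_sq_le {n m : ℕ} {x w : Fin m → ℝ} (hw : ∀ j, 0 < w j)
    (hsum : ∑ j, w j = 2) {p : ℕ → Polynomial ℝ}
    (hdeg : ∀ ℓ, ℓ ≤ n → (p ℓ).natDegree = ℓ)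
    (horth : ∀ ℓ ℓ', ℓ ≤ n → ℓ' ≤ n →
      (∫ y in (-1 : ℝ)..1, (p ℓ).eval y * (p ℓ').eval y) = if ℓ = ℓ' then 1 else 0)
    {η : ℝ} (hη : 0 < η)
    (hMZ : ∀ χ : Polynomial ℝ, χ.natDegree ≤ n →
      |(∑ j, w j * (χ.eval (x j)) ^ 2) - ∫ y in (-1 : ℝ)..1, (χ.eval y) ^ 2| ≤
        η * ∫ y in (-1 : ℝ)..1, (χ.eval y) ^ 2)
    {g : ℝ → ℝ} {M : ℝ} (hg : ∀ j, |g (x j)| ≤ M) :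
    ∫ y in (-1 : ℝ)..1, ((hyper w x p n g).eval y) ^ 2 ≤ (1 + η) * (2 * M ^ 2) := by
  have hdisc := (abs_le.mp (hMZ _ (natDegree_hyper_le w x hdeg g))).2
  have hyoung : (1 + η) * (2 * discInner w x g (fun y => (hyper w x p n g).eval y)) ≤
      (1 + η) ^ 2 * ((∑ j, w j) * M ^ 2) + ∑ j, w j * ((hyper w x p n g).eval (x j)) ^ 2 := by
    simp only [discInner, Finset.sum_mul, Finset.mul_sum, ← Finset.sum_add_distrib]
    refine Finset.sum_le_sum fun j _ => ?_
    have hgM : g (x j) ^ 2 ≤ M ^ 2 := sq_le_sq' (abs_le.mp (hg j)).1 (abs_le.mp (hg j)).2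
    have hgM' := mul_le_mul_of_nonneg_left hgM (mul_nonneg (sq_nonneg (1 + η)) (hw j).le)
    have hsq := mul_nonneg (hw j).le
      (sq_nonneg ((1 + η) * g (x j) - (hyper w x p n g).eval (x j)))
    linarith
  rw [← integral_hyper_sq w x horth, hsum] at hyoung
  refine le_of_mul_le_mul_left ?_ (show 0 < 1 + η by linarith)
  linarith

/-- error bound `‖L_n f − f‖₂ ≤ (1/√(1−η) + 1) √2 E_k(f)`. -/
theorem hyper_error_bound
    (n k m : ℕ) (hn : 1 ≤ n) (hk0 : 0 < k) (hkn : k ≤ n)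
    (x w : Fin m → ℝ)
    (hx : ∀ j, x j ∈ Set.Icc (-1 : ℝ) 1)
    (hw : ∀ j, 0 < w j)
    (hex : ∀ g : Polynomial ℝ, g.natDegree ≤ n + k →
      ∑ j, w j * g.eval (x j) = ∫ y in (-1 : ℝ)..1, g.eval y)
    (p : ℕ → Polynomial ℝ)
    (hdeg : ∀ ℓ, ℓ ≤ n → (p ℓ).natDegree = ℓ)
    (horth : ∀ ℓ ℓ', ℓ ≤ n → ℓ' ≤ n →
      (∫ y in (-1 : ℝ)..1, (p ℓ).eval y * (p ℓ').eval y) = if ℓ = ℓ' then 1 else 0)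
    (η : ℝ) (hη : η ∈ Set.Ioo (0 : ℝ) 1)
    (hMZ : ∀ χ : Polynomial ℝ, χ.natDegree ≤ n →
      |(∑ j, w j * (χ.eval (x j)) ^ 2) - ∫ y in (-1 : ℝ)..1, (χ.eval y) ^ 2| ≤
        η * ∫ y in (-1 : ℝ)..1, (χ.eval y) ^ 2)
    (f : ℝ → ℝ) (hf : ContinuousOn f (Set.Icc (-1 : ℝ) 1))
    :
    Real.sqrt (∫ y in (-1 : ℝ)..1, ((hyper w x p n f).eval y - f y) ^ 2) ≤
      (1 / Real.sqrt (1 - η) + 1) * Real.sqrt 2 *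
        ⨅ χ : {q : Polynomial ℝ // q.natDegree ≤ k},
          ⨆ t : Set.Icc (-1 : ℝ) 1, |f t - (χ : Polynomial ℝ).eval (t : ℝ)| := by
  have hη1 : 0 < 1 - η := sub_pos.mpr hη.2
  set c := 1 / Real.sqrt (1 - η) with hc
  have hc0 : 0 < c := by positivity
  have hηc : 1 + η ≤ c ^ 2 := by
    rw [hc, div_pow, Real.sq_sqrt hη1.le, one_pow, le_div_iff₀ hη1]
    nlinarith [sq_nonneg η]
  have hsum : ∑ j, w j = 2 := by
    have h := hex 1 (by simp)
    norm_num at h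
    exact h
  rw [Real.mul_iInf_of_nonneg (by positivity)]
  have : Nonempty {q : Polynomial ℝ // q.natDegree ≤ k} := ⟨⟨0, by simp⟩⟩
  refine le_ciInf fun ⟨χ, hχ⟩ => ?_
  set M := ⨆ t : Set.Icc (-1 : ℝ) 1, |f t - χ.eval (t : ℝ)|
  have hgcont : ContinuousOn (fun y => f y - χ.eval y) (Set.Icc (-1 : ℝ) 1) :=
    hf.sub χ.continuous.continuousOn
  have hbdd : BddAbove (Set.range fun t : Set.Icc (-1 : ℝ) 1 => |f t - χ.eval (t : ℝ)|) :=
    isCompact_range (continuousOn_iff_continuous_domRestrict.mp hgcont.abs) |>.bddAbove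
  have hgM : ∀ y ∈ Set.Icc (-1 : ℝ) 1, |f y - χ.eval y| ≤ M :=
    fun y hy => le_ciSup hbdd ⟨y, hy⟩
  have hM0 : 0 ≤ M := (abs_nonneg _).trans (hgM 0 (by norm_num))
  set u := hyper w x p n (fun y => f y - χ.eval y) with hu
  have hu_eq : u = hyper w x p n f - χ := by
    rw [hu, hyper_sub, hyper_eval_eq_self hkn hex hdeg horth hχ]
  have hu_int : ∫ y in (-1 : ℝ)..1, (u.eval y) ^ 2 ≤ c ^ 2 * (2 * M ^ 2) :=
    (integral_hyper_sq_le hw hsum hdeg horth hη.1 hMZ fun j => hgM _ (hx j)).trans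
      (mul_le_mul_of_nonneg_right hηc (by positivity))
  have hucont : Continuous fun y => (u.eval y) ^ 2 := by fun_prop
  have hpointwise : ∀ y ∈ Set.Icc (-1 : ℝ) 1, ((hyper w x p n f).eval y - f y) ^ 2 ≤
      (1 + 1 / c) * (u.eval y) ^ 2 + (1 + c) * M ^ 2 := by
    intro y hy
    have hsplit : (hyper w x p n f).eval y - f y = u.eval y - (f y - χ.eval y) := by
      rw [hu_eq, Polynomial.eval_sub]
      ring
    have hg2 : (f y - χ.eval y) ^ 2 ≤ M ^ 2 :=
      sq_le_sq' (abs_le.mp (hgM y hy)).1 (abs_le.mp (hgM y hy)).2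
    have hyoung : 0 ≤ (1 / c) * (u.eval y + c * (f y - χ.eval y)) ^ 2 := by positivity
    have hexp : (1 / c) * (u.eval y + c * (f y - χ.eval y)) ^ 2 =
        (1 / c) * (u.eval y) ^ 2 + 2 * u.eval y * (f y - χ.eval y) +
          c * (f y - χ.eval y) ^ 2 := by
      field_simp
      ring
    rw [hsplit]
    nlinarith [mul_le_mul_of_nonneg_left hg2 (show 0 ≤ 1 + c by positivity)]
  have hle : ∫ y in (-1 : ℝ)..1, ((hyper w x p n f).eval y - f y) ^ 2 ≤
      ∫ y in (-1 : ℝ)..1, ((1 + 1 / c) * (u.eval y) ^ 2 + (1 + c) * M ^ 2) := by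
    refine intervalIntegral.integral_mono_on (by norm_num) ?_ ?_ hpointwise
    · refine ContinuousOn.intervalIntegrable ?_
      rw [Set.uIcc_of_le (by norm_num)]
      exact ((hyper w x p n f).continuous.continuousOn.sub hf).pow 2
    · exact Continuous.intervalIntegrable (by fun_prop) _ _
  rw [intervalIntegral.integral_add ((hucont.const_mul _).intervalIntegrable _ _)
    (continuous_const.intervalIntegrable _ _), intervalIntegral.integral_const_mul,
    intervalIntegral.integral_const, smul_eq_mul] at hle
  refine Real.sqrt_le_iff.mpr ⟨by positivity, hle.trans ?_⟩
  have hscaled := mul_le_mul_of_nonneg_left hu_int (show 0 ≤ 1 + 1 / c by positivity)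
  have hexp : (1 + 1 / c) * (c ^ 2 * (2 * M ^ 2)) = (c ^ 2 + c) * (2 * M ^ 2) := by
    field_simp
  rw [mul_pow, mul_pow, Real.sq_sqrt (by norm_num)]
  linarith
end
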